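/- Let ν > 0, n ≥ 1 and 0 ≤ θ ≤ ν/2. Let v : ℝ^d → ℝ^d be continuously differentiable with compact support and suppose: (i) the error inequality ν ∫_Ω |∇v|² dx + n ∫_{Ω_S} |v|² dx ≤ ∫_{Ω_S} f·v dx + ∫_Σ |g·v| d𝓗^{d−1} + θ ∫_Ω |∇v|² dx holds; (ii) the interpolation trace inequality ∫_Σ |v|² d𝓗^{d−1} ≤ C_T · (∫_Ω |∇v|² dx)^{1/2} · (∫_{Ω_S} |v|² dx)^{1/2} holds for some C_T ≥ 0. Then there is a constant C depending only on ν, C_T, ∫_{Ω_S} |f|² dx and ∫_Σ |g|² d𝓗^{d−1} (but not on n) such that (∫_Ω |∇v|² dx)^{1/2} ≤ C · n^{-1/4}. (This is the improved volume-penalization error estimate (vol:4) of Theorem 1, with v playing the role of u − u_n and θ the absorbed convective contribution under the smallness assumption on f.) -/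

import Mathlib

open MeasureTheory
open scoped RealInnerProductSpace

noncomputable section

/-- `|∇v|²(x) = ∑_{i,j} (∂_j v_i(x))²`. -/
def gradSq {d : ℕ} (v : EuclideanSpace ℝ (Fin d) → EuclideanSpace ℝ (Fin d))
    (x : EuclideanSpace ℝ (Fin d)) : ℝ :=
  ∑ j : Fin d, ‖fderiv ℝ v x (EuclideanSpace.single j 1)‖ ^ 2

/-- Cauchy–Schwarz for the square-integrable norms of two maps. -/
lemma integral_norm_mul_norm_le_sqrt_mul_sqrt {α E : Type*} [MeasurableSpace α] {μ : Measure α}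
    [NormedAddCommGroup E] {f v : α → E}
    (hf : Integrable (fun x => ‖f x‖ ^ 2) μ) (hv : Integrable (fun x => ‖v x‖ ^ 2) μ) :
    Integrable (fun x => ‖f x‖ * ‖v x‖) μ ∧
      ∫ x, ‖f x‖ * ‖v x‖ ∂μ ≤ √(∫ x, ‖f x‖ ^ 2 ∂μ) * √(∫ x, ‖v x‖ ^ 2 ∂μ) := by
  have key : ∀ {u : α → E}, Integrable (fun x => ‖u x‖ ^ 2) μ →
      MemLp (fun x => ‖u x‖) 2 μ := by
    intro u hu
    have hm : AEStronglyMeasurable (fun x => ‖u x‖) μ := by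
      have := (Real.continuous_sqrt.comp_aestronglyMeasurable hu.aestronglyMeasurable)
      simpa [Function.comp_def, Real.sqrt_sq] using this
    exact (memLp_two_iff_integrable_sq hm).2 hu
  have hf' := key hf
  have hv' := key hv
  refine ⟨hf'.integrable_mul hv', ?_⟩
  have h := integral_mul_le_Lp_mul_Lq_of_nonneg (μ := μ) (p := 2) (q := 2)
    Real.HolderConjugate.two_two
    (Filter.Eventually.of_forall fun x => norm_nonneg (f x))
    (Filter.Eventually.of_forall fun x => norm_nonneg (v x))
    (by simpa using hf') (by simpa using hv')
  simpa [Real.sqrt_eq_rpow] using h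

/-- The Cauchy–Schwarz inequality for `|⟪f, v⟫|`, valid without measurability of `f`. -/
lemma integral_abs_inner_le_sqrt_mul_sqrt {α E : Type*} [MeasurableSpace α] {μ : Measure α}
    [NormedAddCommGroup E] [InnerProductSpace ℝ E] {f v : α → E}
    (hf : Integrable (fun x => ‖f x‖ ^ 2) μ) (hv : Integrable (fun x => ‖v x‖ ^ 2) μ) :
    ∫ x, |⟪f x, v x⟫| ∂μ ≤ √(∫ x, ‖f x‖ ^ 2 ∂μ) * √(∫ x, ‖v x‖ ^ 2 ∂μ) := by
  obtain ⟨hi, hle⟩ := integral_norm_mul_norm_le_sqrt_mul_sqrt hf hv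
  exact (integral_mono_of_nonneg (Filter.Eventually.of_forall fun _ => abs_nonneg _) hi
    (Filter.Eventually.of_forall fun x => abs_real_inner_le_norm (f x) (v x))).trans hle

/-- A continuous compactly supported map is square integrable for a finite measure. -/
lemma integrable_norm_sq_of_hasCompactSupport {α E : Type*} [TopologicalSpace α]
    [MeasurableSpace α] [OpensMeasurableSpace α] {μ : Measure α} [IsFiniteMeasure μ]
    [NormedAddCommGroup E] {v : α → E} (hv : Continuous v) (hc : HasCompactSupport v) :
    Integrable (fun x => ‖v x‖ ^ 2) μ := by
  obtain ⟨B, hB⟩ := hc.exists_bound_of_continuous hv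
  refine Integrable.of_bound (hv.norm.pow 2).aestronglyMeasurable (B ^ 2)
    (Filter.Eventually.of_forall fun x => ?_)
  rw [Real.norm_of_nonneg (by positivity)]
  exact pow_le_pow_left₀ (norm_nonneg _) (hB x) 2

/-- If `ν/2 x² + m⁴ y² ≤ φ y + κ √(x y)` with `m ≥ 1`, then `m x` is bounded independently
of `m`. -/
lemma mul_le_sqrt_of_penalized_le {ν m x y φ κ : ℝ} (hν : 0 < ν) (hm : 1 ≤ m) (hx : 0 ≤ x)
    (hy : 0 ≤ y) (hφ : 0 ≤ φ) (hκ : 0 ≤ κ)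
    (h : ν / 2 * x ^ 2 + m ^ 4 * y ^ 2 ≤ φ * y + κ * √(x * y)) :
    m * x ≤ √(4 / ν * ((φ + κ) ^ 2 / 4 + κ ^ 2 / ν)) := by
  have hm0 : 0 < m := by linarith
  have hamgm : m ^ 2 * √(x * y) ≤ (m * x + m ^ 3 * y) / 2 := by
    have e : m ^ 2 * √(x * y) = √((m * x) * (m ^ 3 * y)) := by
      rw [show (m * x) * (m ^ 3 * y) = (m ^ 2) ^ 2 * (x * y) by ring,
        Real.sqrt_mul (sq_nonneg _), Real.sqrt_sq (by positivity)]
    rw [e]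
    refine Real.sqrt_le_iff.2 ⟨by positivity, ?_⟩
    nlinarith [sq_nonneg (m * x - m ^ 3 * y)]
  have hscaled : ν / 2 * (m * x) ^ 2 + (m ^ 3 * y) ^ 2
      ≤ φ * (m ^ 3 * y) + κ * ((m * x + m ^ 3 * y) / 2) := by
    have h1 := mul_le_mul_of_nonneg_left h (sq_nonneg m)
    have h2 := mul_le_mul_of_nonneg_left hamgm hκ
    have h3 : φ * (m ^ 2 * y) ≤ φ * (m ^ 3 * y) := by
      gcongr
      norm_num
    nlinarith
  have hκX : 0 ≤ κ * (m * x) := by positivity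
  generalize m * x = X at *
  have hY : 0 ≤ m ^ 3 * y := by positivity
  generalize m ^ 3 * y = Y at *
  apply Real.le_sqrt_of_sq_le
  have h4 : κ * X ≤ ν / 4 * X ^ 2 + κ ^ 2 / ν := by
    have e : ν / 4 * X ^ 2 + κ ^ 2 / ν - κ * X = ν * (X / 2 - κ / ν) ^ 2 := by
      field_simp
      ring
    have : 0 ≤ ν * (X / 2 - κ / ν) ^ 2 := by positivity
    linarith
  have h5 : ν / 4 * X ^ 2 ≤ (φ + κ) ^ 2 / 4 + κ ^ 2 / ν := by
    nlinarith [sq_nonneg (Y - (φ + κ) / 2), mul_nonneg hκ hY]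
  calc X ^ 2 = 4 / ν * (ν / 4 * X ^ 2) := by field_simp
    _ ≤ _ := by gcongr

/-- Improved volume-penalization error estimate (vol:4) of Theorem 1: under
the error inequality and the interpolation trace inequality, the
`H¹`-seminorm of `v = u − u_n` on `Ω` is `O(n^{-1/4})`, with a constant
depending only on `ν`, `C_T`, `∫_{Ω_S} |f|²` and `∫_Σ |g|²` (but not on `n`). -/
theorem volume_penalization_improved_error_estimate
    (d : ℕ) (hd : 1 ≤ d) :
    ∃ C : ℝ → ℝ → ℝ → ℝ → ℝ,
      ∀ (Ω ΩS Sig : Set (EuclideanSpace ℝ (Fin d))),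
        IsOpen Ω → Bornology.IsBounded Ω → MeasurableSet ΩS → ΩS ⊆ Ω →
        MeasurableSet Sig → μH[(d : ℝ) - 1] Sig < ⊤ →
      ∀ (f g v : EuclideanSpace ℝ (Fin d) → EuclideanSpace ℝ (Fin d)),
        IntegrableOn (fun x => ‖f x‖ ^ 2) ΩS →
        Integrable (fun x => ‖g x‖ ^ 2) (μH[(d : ℝ) - 1].restrict Sig) →
        ContDiff ℝ 1 v → HasCompactSupport v →
      ∀ (ν n θ C_T : ℝ),
        0 < ν → 1 ≤ n → 0 ≤ θ → θ ≤ ν / 2 → 0 ≤ C_T →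
        (ν * ∫ x in Ω, gradSq v x) + (n * ∫ x in ΩS, ‖v x‖ ^ 2)
          ≤ (∫ x in ΩS, ⟪f x, v x⟫)
            + (∫ x in Sig, |⟪g x, v x⟫| ∂μH[(d : ℝ) - 1])
            + θ * ∫ x in Ω, gradSq v x →
        (∫ x in Sig, ‖v x‖ ^ 2 ∂μH[(d : ℝ) - 1])
          ≤ C_T * Real.sqrt (∫ x in Ω, gradSq v x)
              * Real.sqrt (∫ x in ΩS, ‖v x‖ ^ 2) →
        Real.sqrt (∫ x in Ω, gradSq v x)
          ≤ C ν C_T (∫ x in ΩS, ‖f x‖ ^ 2)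
              (∫ x in Sig, ‖g x‖ ^ 2 ∂μH[(d : ℝ) - 1])
            * n ^ (-(1/4) : ℝ) := by
  refine ⟨fun ν C_T F G => √(4 / ν * ((√F + √G * √C_T) ^ 2 / 4 + (√G * √C_T) ^ 2 / ν)), ?_⟩
  intro Ω ΩS Sig _ hΩb _ hsub _ hSig f g v hf hg hv hvc ν n θ C_T hν hn _ hθ hC herr htr
  have : IsFiniteMeasure (volume.restrict ΩS) :=
    ⟨by simpa using (hΩb.subset hsub).measure_lt_top⟩
  have : IsFiniteMeasure (μH[(d : ℝ) - 1].restrict Sig) := ⟨by simpa using hSig⟩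
  have hvS : Integrable (fun x => ‖v x‖ ^ 2) (volume.restrict ΩS) :=
    integrable_norm_sq_of_hasCompactSupport hv.continuous hvc
  have hvSig : Integrable (fun x => ‖v x‖ ^ 2) (μH[(d : ℝ) - 1].restrict Sig) :=
    integrable_norm_sq_of_hasCompactSupport hv.continuous hvc
  have hfv := ((le_abs_self _).trans abs_integral_le_integral_abs).trans
    (integral_abs_inner_le_sqrt_mul_sqrt hf hvS)
  have hgv := integral_abs_inner_le_sqrt_mul_sqrt hg hvSig
  have hX : 0 ≤ ∫ x in Ω, gradSq v x :=
    integral_nonneg fun x => Finset.sum_nonneg fun j _ => by positivity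
  have hY : 0 ≤ ∫ x in ΩS, ‖v x‖ ^ 2 := integral_nonneg fun x => by positivity
  generalize (∫ x in Ω, gradSq v x) = X at *
  generalize (∫ x in ΩS, ‖v x‖ ^ 2) = Y at *
  generalize (∫ x in ΩS, ‖f x‖ ^ 2) = F at *
  generalize (∫ x in Sig, ‖g x‖ ^ 2 ∂μH[(d : ℝ) - 1]) = G at *
  generalize (∫ x in Sig, ‖v x‖ ^ 2 ∂μH[(d : ℝ) - 1]) = T at *
  have hn0 : 0 < n := by linarith
  have hm : 1 ≤ n ^ (1 / 4 : ℝ) := Real.one_le_rpow hn (by norm_num)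
  have hm4 : (n ^ (1 / 4 : ℝ)) ^ 4 = n := by
    rw [← Real.rpow_natCast, ← Real.rpow_mul hn0.le]
    norm_num
  have hT : √T ≤ √C_T * √(√X * √Y) := by
    rw [← Real.sqrt_mul hC, ← mul_assoc]
    exact Real.sqrt_le_sqrt htr
  have hGT := mul_le_mul_of_nonneg_left hT (Real.sqrt_nonneg G)
  have hbound := mul_le_sqrt_of_penalized_le (x := √X) (y := √Y) (φ := √F) (κ := √G * √C_T)
    hν hm (by positivity) (by positivity) (by positivity) (by positivity) (by
      rw [hm4, Real.sq_sqrt hX, Real.sq_sqrt hY]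
      have := mul_le_mul_of_nonneg_right hθ hX
      linarith)
  rw [Real.rpow_neg hn0.le, ← div_eq_mul_inv, le_div_iff₀ (by positivity), mul_comm]
  exact hbound
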